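/- Theorem 3 (spinor type-2 Bishop equation): let λ : ℝ → ℂ² be differentiable with |λ₁(s)|² + |λ₂(s)|² = 1 for all s, let ε₁, ε₂ : ℝ → ℝ, and set ζ₁(s) = a(λ(s)), ζ₂(s) = b(λ(s)), B(s) = c(λ(s)). If the type-2 Bishop equations hold, i.e., ζ₁′(s) = −ε₁(s)·B(s), ζ₂′(s) = −ε₂(s)·B(s) and B′(s) = ε₁(s)·ζ₁(s) + ε₂(s)·ζ₂(s) for all s, then λ satisfies the single spinor equation λ′(s) = (1/2)·(ε₁(s) + i·ε₂(s))·λ̂(s) for all s. -/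

import Mathlib

open Complex

noncomputable section

/-- The mate (or conjugate) of a spinor `ψ = (ψ₁, ψ₂)` is `ψ̂ = (-conj ψ₂, conj ψ₁)`. -/
def mate (ψ : ℂ × ℂ) : ℂ × ℂ := (-(starRingEnd ℂ) ψ.2, (starRingEnd ℂ) ψ.1)

/-- The real vector `a(ψ) = (Re(ψ₁² - ψ₂²), -Im(ψ₁² + ψ₂²), -2 Re(ψ₁ψ₂))`. -/
def sa (ψ : ℂ × ℂ) : EuclideanSpace ℝ (Fin 3) :=
  !₂[(ψ.1 ^ 2 - ψ.2 ^ 2).re, -(ψ.1 ^ 2 + ψ.2 ^ 2).im, -2 * (ψ.1 * ψ.2).re]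

/-- The real vector `b(ψ) = (Im(ψ₁² - ψ₂²), Re(ψ₁² + ψ₂²), -2 Im(ψ₁ψ₂))`. -/
def sb (ψ : ℂ × ℂ) : EuclideanSpace ℝ (Fin 3) :=
  !₂[(ψ.1 ^ 2 - ψ.2 ^ 2).im, (ψ.1 ^ 2 + ψ.2 ^ 2).re, -2 * (ψ.1 * ψ.2).im]

/-- The real vector `c(ψ) = (2 Re(ψ₁ conj ψ₂), -2 Im(ψ₁ conj ψ₂), |ψ₁|² - |ψ₂|²)`. -/
def sc (ψ : ℂ × ℂ) : EuclideanSpace ℝ (Fin 3) :=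
  !₂[2 * (ψ.1 * (starRingEnd ℂ) ψ.2).re, -2 * (ψ.1 * (starRingEnd ℂ) ψ.2).im,
    ‖ψ.1‖ ^ 2 - ‖ψ.2‖ ^ 2]

/-- Reinterpret a plain vector in `Fin 3 → ℝ` as an element of Euclidean 3-space. -/
def toE (v : Fin 3 → ℝ) : EuclideanSpace ℝ (Fin 3) := WithLp.toLp 2 v


theorem hasDerivAt_vec3 {f g h : ℝ → ℝ} {f' g' h' : ℝ} {s : ℝ} (hf : HasDerivAt f f' s)
    (hg : HasDerivAt g g' s) (hh : HasDerivAt h h' s) :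
    HasDerivAt (fun t => (!₂[f t, g t, h t] : EuclideanSpace ℝ (Fin 3))) !₂[f', g', h'] s := by
  have h1 : HasDerivAt (fun t => (![f t, g t, h t] : Fin 3 → ℝ)) ![f', g', h'] s := by
    rw [hasDerivAt_pi]
    intro i
    fin_cases i
    · exact hf
    · exact hg
    · exact hh
  exact ((EuclideanSpace.equiv (Fin 3) ℝ).symm.toContinuousLinearMap.hasFDerivAt).comp_hasDerivAt s h1

theorem hasDerivAt_re' {f : ℝ → ℂ} {f' : ℂ} {s : ℝ} (hf : HasDerivAt f f' s) :
    HasDerivAt (fun t => (f t).re) f'.re s :=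
  Complex.reCLM.hasFDerivAt.comp_hasDerivAt s hf

theorem hasDerivAt_im' {f : ℝ → ℂ} {f' : ℂ} {s : ℝ} (hf : HasDerivAt f f' s) :
    HasDerivAt (fun t => (f t).im) f'.im s :=
  Complex.imCLM.hasFDerivAt.comp_hasDerivAt s hf

/-- Theorem 3 (spinor type-2 Bishop equation): if the triad `ζ₁ = a(λ), ζ₂ = b(λ),
B = c(λ)` associated to a unit differentiable spinor field satisfies the type-2 Bishop
equations with Bishop curvatures `ε₁, ε₂`, then `λ' = (1/2)(ε₁ + i ε₂) λ̂`. -/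
theorem spinor_type2_bishop_equation (lam : ℝ → ℂ × ℂ) (hlam : Differentiable ℝ lam)
    (hunit : ∀ s, ‖(lam s).1‖ ^ 2 + ‖(lam s).2‖ ^ 2 = 1)
    (ε₁ ε₂ : ℝ → ℝ)
    (hζ₁ : ∀ s, deriv (fun t => sa (lam t)) s = (-ε₁ s) • sc (lam s))
    (hζ₂ : ∀ s, deriv (fun t => sb (lam t)) s = (-ε₂ s) • sc (lam s))
    (hB : ∀ s, deriv (fun t => sc (lam t)) s = ε₁ s • sa (lam s) + ε₂ s • sb (lam s)) :
    ∀ s, deriv lam s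
      = ((1 : ℂ) / 2 * ((ε₁ s : ℂ) + Complex.I * (ε₂ s : ℂ))) • mate (lam s) := by
  intro s
  have hl := (hlam s).hasDerivAt
  have h1 := hζ₁ s
  have h2 := hζ₂ s
  have hu := hunit s
  have hx : HasDerivAt (fun t => (lam t).1) (deriv lam s).1 s :=
    (ContinuousLinearMap.fst ℝ ℂ ℂ).hasFDerivAt.comp_hasDerivAt s hl
  have hy : HasDerivAt (fun t => (lam t).2) (deriv lam s).2 s :=
    (ContinuousLinearMap.snd ℝ ℂ ℂ).hasFDerivAt.comp_hasDerivAt s hl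
  have hm := (hx.pow 2).sub (hy.pow 2)
  have hp := (hx.pow 2).add (hy.pow 2)
  have hxy := hx.mul hy
  have ha := hasDerivAt_vec3 (hasDerivAt_re' hm) (hasDerivAt_im' hp).neg
    ((hasDerivAt_re' hxy).const_mul (-2))
  have hb := hasDerivAt_vec3 (hasDerivAt_im' hm) (hasDerivAt_re' hp)
    ((hasDerivAt_im' hxy).const_mul (-2))
  have ha' := ha.deriv.symm.trans h1
  have hb' := hb.deriv.symm.trans h2
  clear ha hb h1 h2 hm hp hxy hx hy hl
  generalize deriv lam s = d at *
  generalize lam s = l at *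
  obtain ⟨x, y⟩ := l
  obtain ⟨p, q⟩ := d
  have a0 := congrArg (fun v : EuclideanSpace ℝ (Fin 3) => v 0) ha'
  have a1 := congrArg (fun v : EuclideanSpace ℝ (Fin 3) => v 1) ha'
  have a2 := congrArg (fun v : EuclideanSpace ℝ (Fin 3) => v 2) ha'
  have b0 := congrArg (fun v : EuclideanSpace ℝ (Fin 3) => v 0) hb'
  have b1 := congrArg (fun v : EuclideanSpace ℝ (Fin 3) => v 1) hb'
  have b2 := congrArg (fun v : EuclideanSpace ℝ (Fin 3) => v 2) hb'
  clear ha' hb'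
  generalize ε₁ s = e at *
  generalize ε₂ s = f at *
  simp [sc, Complex.sq_norm, Complex.normSq_apply] at a0 a1 a2 b0 b1 b2
  set E : ℂ := (1 : ℂ) / 2 * ((e : ℂ) + Complex.I * (f : ℂ)) with hE
  have k1 : x * (p + E * (starRingEnd ℂ) y) = 0 := by
    apply Complex.ext <;> simp [hE] <;> linarith
  have k2 : y * (q - E * (starRingEnd ℂ) x) = 0 := by
    apply Complex.ext <;> simp [hE] <;> linarith
  have k3 : (p + E * (starRingEnd ℂ) y) * y + x * (q - E * (starRingEnd ℂ) x) = 0 := by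
    apply Complex.ext <;> simp [hE] <;> linarith
  have hne : x ≠ 0 ∨ y ≠ 0 := by
    by_contra! h
    simp [h.1, h.2] at hu
  have key : p + E * (starRingEnd ℂ) y = 0 ∧ q - E * (starRingEnd ℂ) x = 0 := by
    rcases hne with h | h
    · have u := (mul_eq_zero.mp k1).resolve_left h
      rw [u] at k3
      simp only [zero_mul, zero_add] at k3
      exact ⟨u, (mul_eq_zero.mp k3).resolve_left h⟩
    · have u := (mul_eq_zero.mp k2).resolve_left h
      rw [u] at k3
      simp only [mul_zero, add_zero] at k3
      exact ⟨(mul_eq_zero.mp k3).resolve_right h, u⟩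
  apply Prod.ext
  · simp only [mate, Prod.smul_fst, smul_eq_mul]
    linear_combination key.1
  · simp only [mate, Prod.smul_snd, smul_eq_mul]
    linear_combination key.2
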